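/- arXiv:1802.02718 — 5 statements merged into one kernel-verified Lean document; each statement's English description precedes it below -/
import Mathlib

section
/- Every locally polarizing [0,1]-martingale is strongly polarizing. That is, if a [0,1]-martingale sequence X_0, X_1, X_2, … is (α, τ(·), θ(·))-locally polarizing for some α > 0 and some functions τ : (0,∞) → (0,∞) and θ : (0,∞) → (0,∞), then for every γ > 0 there exist η < 1 and β < ∞ such that for all t, P(γ^t < X_t < 1 − γ^t) < β·η^t. -/
open MeasureTheory ProbabilityTheory Real Set

/-- The σ-algebra generated by a single real random variable. -/
noncomputable def sigmaOf {Ω : Type*} (X : Ω → ℝ) : MeasurableSpace Ω :=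
  MeasurableSpace.comap X inferInstance

/-- A `[0,1]`-valued process `X` is `(α, τ(·), θ(·))`-*locally polarizing* (w.r.t. the
probability measure `μ`) if it has:
* *variance in the middle*: for every `τ' > 0`, `θ τ' > 0` and, for all `j`,
  `E[(X_{j+1} − X_j)² | X_j] ≥ θ τ'` almost surely on the event `X_j ∈ (τ', 1 − τ')`;
* *suction at the ends*: `α > 0` and for every `c > 0`, `τ c > 0` and, for all `j`,
  `P(X_{j+1} ≤ X_j / c | X_j) ≥ α` a.s. on `{X_j ≤ τ c}`, and
  `P(1 − X_{j+1} ≤ (1 − X_j)/c | X_j) ≥ α` a.s. on `{1 − X_j ≤ τ c}`. -/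
def LocallyPolarizing {Ω : Type*} [m0 : MeasurableSpace Ω] (μ : Measure Ω)
    (X : ℕ → Ω → ℝ) (α : ℝ) (τ θ : ℝ → ℝ) : Prop :=
  0 < α ∧
  (∀ τ' : ℝ, 0 < τ' → 0 < θ τ' ∧ ∀ j : ℕ, ∀ᵐ ω ∂μ,
      X j ω ∈ Set.Ioo τ' (1 - τ') →
      θ τ' ≤ (μ[(fun ω' => (X (j+1) ω' - X j ω') ^ 2) | sigmaOf (X j)]) ω) ∧
  (∀ c : ℝ, 0 < c → 0 < τ c ∧
    (∀ j : ℕ, ∀ᵐ ω ∂μ, X j ω ≤ τ c →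
      α ≤ (μ[Set.indicator {ω' | X (j+1) ω' ≤ X j ω' / c} (fun _ => (1:ℝ)) | sigmaOf (X j)]) ω) ∧
    (∀ j : ℕ, ∀ᵐ ω ∂μ, 1 - X j ω ≤ τ c →
      α ≤ (μ[Set.indicator {ω' | 1 - X (j+1) ω' ≤ (1 - X j ω') / c} (fun _ => (1:ℝ)) | sigmaOf (X j)]) ω))

/-- The one-step bound `E[Z ^ p] ≤ (1 - α (1 - p - c ^ (-p))) a ^ p` for a nonnegative random
variable of mean at most `a` which is at most `a / c` with probability at least `α`. -/
theorem integral_rpow_le_of_suction {Ω : Type*} [MeasurableSpace Ω] (ν : Measure Ω)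
    [IsProbabilityMeasure ν] {Z : Ω → ℝ} (hZm : Measurable Z) (hZ : ∀ᵐ y ∂ν, Z y ∈ Icc (0 : ℝ) 1)
    {a c p α : ℝ} (ha : 0 ≤ a) (hmean : ∫ y, Z y ∂ν ≤ a) (hc : 0 < c) (hp : 0 < p) (hp1 : p ≤ 1)
    (hK : 0 ≤ 1 - p - c ^ (-p)) (hα : α ≤ ν.real {y | Z y ≤ a / c}) :
    ∫ y, Z y ^ p ∂ν ≤ (1 - α * (1 - p - c ^ (-p))) * a ^ p := by
  have hZint : Integrable Z ν := .of_mem_Icc 0 1 hZm.aemeasurable hZ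
  rcases ha.eq_or_lt with rfl | ha
  · have h0 : ∫ y, Z y ∂ν = 0 :=
      le_antisymm hmean (integral_nonneg_of_ae (hZ.mono fun y hy => hy.1))
    have h1 : Z =ᵐ[ν] 0 :=
      (integral_eq_zero_iff_of_nonneg_ae (hZ.mono fun y hy => hy.1) hZint).1 h0
    have h2 : ∫ y, Z y ^ p ∂ν = 0 := by
      refine integral_eq_zero_of_ae (h1.mono fun y hy => ?_)
      simp [hy, zero_rpow hp.ne']
    rw [h2, zero_rpow hp.ne', mul_zero]
  set K := 1 - p - c ^ (-p) with hKdef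
  set D : Set Ω := {y | Z y ≤ a / c} with hD
  have hDm : MeasurableSet D := measurableSet_le hZm measurable_const
  have hap : 0 < a ^ p := rpow_pos_of_pos ha p
  have key : ∀ y, 0 ≤ Z y →
      Z y ^ p ≤ a ^ p * (1 - p) + a ^ p * p / a * Z y - a ^ p * K * D.indicator (fun _ => 1) y := by
    intro y hy
    have hu : 0 ≤ Z y / a := by positivity
    have hZu : Z y ^ p = a ^ p * (Z y / a) ^ p := by
      rw [← mul_rpow ha.le hu, mul_div_cancel₀ _ ha.ne']
    have main : (Z y / a) ^ p ≤ 1 - p + p * (Z y / a) - K * D.indicator (fun _ => 1) y := by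
      by_cases hyD : y ∈ D
      · rw [indicator_of_mem hyD]
        have h1 : Z y / a ≤ c⁻¹ := by
          rw [div_le_iff₀ ha]
          calc Z y ≤ a / c := hyD
            _ = c⁻¹ * a := by ring
        have h2 : (Z y / a) ^ p ≤ c ^ (-p) := by
          rw [rpow_neg hc.le, ← inv_rpow hc.le]
          exact rpow_le_rpow hu h1 hp.le
        have h3 : 0 ≤ p * (Z y / a) := by positivity
        rw [hKdef]
        linarith
      · rw [indicator_of_notMem hyD]
        have := rpow_one_add_le_one_add_mul_self (s := Z y / a - 1) (by linarith) hp.le hp1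
        rw [add_sub_cancel] at this
        linarith
    rw [hZu]
    calc _ ≤ a ^ p * (1 - p + p * (Z y / a) - K * D.indicator (fun _ => 1) y) := by gcongr
      _ = _ := by ring
  have hi1 : Integrable (fun y => a ^ p * (1 - p) + a ^ p * p / a * Z y) ν :=
    (integrable_const _).add (hZint.const_mul _)
  have hi2 : Integrable (fun y => a ^ p * K * D.indicator (fun _ => (1 : ℝ)) y) ν :=
    ((integrable_const (1 : ℝ)).indicator hDm).const_mul _
  have hint : ∫ y, Z y ^ p ∂ν ≤ a ^ p * (1 - p) + a ^ p * p / a * ∫ y, Z y ∂ν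
      - a ^ p * K * ν.real D := by
    have hle : ∫ y, Z y ^ p ∂ν ≤ ∫ y, (a ^ p * (1 - p) + a ^ p * p / a * Z y
        - a ^ p * K * D.indicator (fun _ => (1 : ℝ)) y) ∂ν :=
      integral_mono_of_nonneg (hZ.mono fun y hy => rpow_nonneg hy.1 p) (hi1.sub hi2)
        (hZ.mono fun y hy => key y hy.1)
    rw [integral_sub hi1 hi2, integral_add (integrable_const _) (hZint.const_mul _),
      integral_const_mul (a ^ p * p / a), integral_const_mul (a ^ p * K),
      integral_indicator_const _ hDm] at hle
    simpa using hle
  have h4 : a ^ p * p / a * ∫ y, Z y ∂ν ≤ a ^ p * p := by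
    calc a ^ p * p / a * ∫ y, Z y ∂ν ≤ a ^ p * p / a * a := by gcongr
      _ = a ^ p * p := by field_simp
  have h5 : a ^ p * K * α ≤ a ^ p * K * ν.real D := by gcongr
  linarith

/-- The potential driving the proof: suction makes its first summand decay near the ends of
`[0, 1]`, variance makes its second summand decay in the middle. -/
noncomputable def polarPotential (p x : ℝ) : ℝ := min x (1 - x) ^ p + x * (1 - x)

theorem measurable_polarPotential (p : ℝ) : Measurable (polarPotential p) := by
  unfold polarPotential
  fun_prop

theorem polarPotential_mem_Icc {p x : ℝ} (hp : 0 ≤ p) (hx : x ∈ Icc (0 : ℝ) 1) :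
    polarPotential p x ∈ Icc (0 : ℝ) 2 := by
  have h0 : 0 ≤ min x (1 - x) := le_min hx.1 (by linarith [hx.2])
  have h1 : min x (1 - x) ≤ 1 := (min_le_left _ _).trans hx.2
  have h2 := rpow_nonneg h0 p
  have h3 := rpow_le_one h0 h1 hp
  unfold polarPotential
  constructor <;> nlinarith [hx.1, hx.2]

theorem polarPotential_le_two_mul {p x : ℝ} (hp1 : p ≤ 1) (hx : x ∈ Icc (0 : ℝ) 1) :
    polarPotential p x ≤ 2 * min x (1 - x) ^ p := by
  have hx' : 0 ≤ 1 - x := by linarith [hx.2]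
  have h0 : 0 ≤ min x (1 - x) := le_min hx.1 hx'
  have h1 : min x (1 - x) ≤ 1 := (min_le_left _ _).trans hx.2
  have h2 : x * (1 - x) ≤ min x (1 - x) := le_min (by nlinarith [hx.1]) (by nlinarith [hx.2])
  have h3 : min x (1 - x) ≤ min x (1 - x) ^ p := by
    rcases h0.eq_or_lt with h | h
    · rw [← h]
      exact rpow_nonneg le_rfl p
    · simpa using rpow_le_rpow_of_exponent_ge h h1 hp1
  unfold polarPotential
  linarith

/-- One step of a locally polarizing martingale from `x`, with law `ν`, multiplies the expected
potential by at most `1 - δ`. -/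
theorem integral_polarPotential_le (ν : Measure ℝ) [IsProbabilityMeasure ν] {x : ℝ}
    (hx : x ∈ Icc (0 : ℝ) 1) (hν : ∀ᵐ y ∂ν, y ∈ Icc (0 : ℝ) 1) (hmean : ∫ y, y ∂ν = x)
    {α c t s p δ : ℝ} (hc : 0 < c) (hp : 0 < p) (hp1 : p ≤ 1) (hδ : 0 ≤ δ)
    (hK : 0 ≤ 1 - p - c ^ (-p)) (hδK : 2 * δ ≤ α * (1 - p - c ^ (-p))) (hδs : 2 * δ ≤ s)
    (hmid : x ∈ Ioo (min t (1 / 2)) (1 - min t (1 / 2)) → s ≤ ∫ y, (y - x) ^ 2 ∂ν)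
    (hlow : x ≤ t → α ≤ ν.real {y | y ≤ x / c})
    (hhigh : 1 - x ≤ t → α ≤ ν.real {y | 1 - y ≤ (1 - x) / c}) :
    ∫ y, polarPotential p y ∂ν ≤ (1 - δ) * polarPotential p x := by
  have hx' : 0 ≤ 1 - x := by linarith [hx.2]
  have hid : Integrable (fun y : ℝ => y) ν := .of_mem_Icc 0 1 measurable_id.aemeasurable hν
  have hZm : Measurable fun y : ℝ => min y (1 - y) := by fun_prop
  have hZ : ∀ᵐ y ∂ν, min y (1 - y) ∈ Icc (0 : ℝ) 1 := hν.mono fun y hy =>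
    ⟨le_min hy.1 (by linarith [hy.2]), (min_le_left _ _).trans hy.2⟩
  have hZint : Integrable (fun y : ℝ => min y (1 - y)) ν := .of_mem_Icc 0 1 hZm.aemeasurable hZ
  have hm0 : 0 ≤ min x (1 - x) := le_min hx.1 hx'
  have hZmean : ∫ y, min y (1 - y) ∂ν ≤ min x (1 - x) := by
    refine le_min ?_ ?_
    · exact (integral_mono hZint hid fun y => min_le_left _ _).trans hmean.le
    · refine (integral_mono hZint ((integrable_const 1).sub hid) fun y => min_le_right _ _).trans ?_
      simp only [Pi.sub_apply]
      rw [integral_sub (integrable_const _) hid, hmean]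
      simp
  have hZpint : Integrable (fun y : ℝ => min y (1 - y) ^ p) ν :=
    .of_mem_Icc 0 1 (by fun_prop) (hZ.mono fun y hy =>
      ⟨rpow_nonneg hy.1 p, rpow_le_one hy.1 hy.2 hp.le⟩)
  have hsq : Integrable (fun y : ℝ => (y - x) ^ 2) ν :=
    .of_mem_Icc 0 1 (by fun_prop) (hν.mono fun y hy => by
      have := hx.1; have := hx.2; have := hy.1; have := hy.2
      constructor <;> nlinarith)
  have hquad : ∫ y, y * (1 - y) ∂ν = x * (1 - x) - ∫ y, (y - x) ^ 2 ∂ν := by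
    have h : ∀ y : ℝ, y * (1 - y) = x ^ 2 + (1 - 2 * x) * y - (y - x) ^ 2 := fun y => by ring
    have hlin : Integrable (fun y : ℝ => x ^ 2 + (1 - 2 * x) * y) ν :=
      (integrable_const _).add (hid.const_mul _)
    rw [integral_congr_ae (.of_forall h), integral_sub hlin hsq,
      integral_add (integrable_const _) (hid.const_mul _), integral_const_mul, hmean]
    simp
    ring
  have hqint : Integrable (fun y : ℝ => y * (1 - y)) ν :=
    .of_mem_Icc 0 1 (by fun_prop) (hν.mono fun y hy => by
      have := hy.1; have := hy.2
      constructor <;> nlinarith)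
  have hsplit : ∫ y, polarPotential p y ∂ν
      = ∫ y, min y (1 - y) ^ p ∂ν + (x * (1 - x) - ∫ y, (y - x) ^ 2 ∂ν) := by
    unfold polarPotential
    rw [integral_add hZpint hqint, hquad]
  have hvar : 0 ≤ ∫ y, (y - x) ^ 2 ∂ν := integral_nonneg fun y => sq_nonneg _
  have hend : α ≤ ν.real {y | min y (1 - y) ≤ min x (1 - x) / c} →
      ∫ y, polarPotential p y ∂ν ≤ (1 - δ) * polarPotential p x := by
    intro h
    have h1 := integral_rpow_le_of_suction ν hZm hZ hm0 hZmean hc hp hp1 hK h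
    have h2 := mul_le_mul_of_nonneg_left (polarPotential_le_two_mul hp1 hx) hδ
    have h3 := mul_le_mul_of_nonneg_right hδK (rpow_nonneg hm0 p)
    rw [hsplit]
    have h4 : polarPotential p x = min x (1 - x) ^ p + x * (1 - x) := rfl
    linarith
  by_cases hxl : x ≤ min t (1 / 2)
  · refine hend ((hlow (hxl.trans (min_le_left _ _))).trans (measureReal_mono fun y hy => ?_))
    have : x ≤ 1 / 2 := hxl.trans (min_le_right _ _)
    rw [mem_ofPred_eq, min_eq_left (by linarith : x ≤ 1 - x)]
    exact (min_le_left _ _).trans hy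
  by_cases hxr : 1 - x ≤ min t (1 / 2)
  · refine hend ((hhigh (hxr.trans (min_le_left _ _))).trans (measureReal_mono fun y hy => ?_))
    have : 1 - x ≤ 1 / 2 := hxr.trans (min_le_right _ _)
    rw [mem_ofPred_eq, min_eq_right (by linarith : 1 - x ≤ x)]
    exact (min_le_right _ _).trans hy
  · push Not at hxl hxr
    have h1 := hmid ⟨hxl, by linarith⟩
    have h2 := integral_rpow_le_of_suction ν (α := 0) hZm hZ hm0 hZmean hc hp hp1 hK
      measureReal_nonneg
    have h3 := mul_le_mul_of_nonneg_left (polarPotential_mem_Icc hp.le hx).2 hδ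
    rw [hsplit]
    have h4 : polarPotential p x = min x (1 - x) ^ p + x * (1 - x) := rfl
    linarith

/-- The conditional probability of an event about `(X, Y)` given `X`, as a probability under the
regular conditional law of `Y`. -/
theorem condExp_indicator_ae_eq_condDistrib {Ω : Type*} [MeasurableSpace Ω] {μ : Measure Ω}
    [IsProbabilityMeasure μ] {X Y : Ω → ℝ} (hX : Measurable X) (hY : Measurable Y)
    {S : Set (ℝ × ℝ)} (hS : MeasurableSet S) :
    μ[{ω | (X ω, Y ω) ∈ S}.indicator (fun _ => (1 : ℝ)) | sigmaOf X]
      =ᵐ[μ] fun ω => (condDistrib Y X μ (X ω)).real {y | (X ω, y) ∈ S} := by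
  have hint : Integrable (fun ω => S.indicator (fun _ => (1 : ℝ)) (X ω, Y ω)) μ :=
    (integrable_const (1 : ℝ)).indicator ((hX.prodMk hY) hS)
  have h := condExp_prod_ae_eq_integral_condDistrib (μ := μ) hX hY.aemeasurable
    (stronglyMeasurable_const.indicator hS) hint
  refine Filter.EventuallyEq.trans (by rfl) (h.trans (.of_forall fun ω => ?_))
  have hm : MeasurableSet {y | (X ω, y) ∈ S} := measurable_prodMk_left hS
  have := integral_indicator_const (μ := condDistrib Y X μ (X ω)) (1 : ℝ) hm
  rw [smul_eq_mul, mul_one] at this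
  exact this

/-- A property that `Y` has almost surely also holds almost surely under its conditional laws. -/
theorem ae_ae_condDistrib {Ω : Type*} [MeasurableSpace Ω] {μ : Measure Ω}
    [IsProbabilityMeasure μ] {X Y : Ω → ℝ} (hX : Measurable X) (hY : Measurable Y)
    {s : Set ℝ} (hs : MeasurableSet s) (h : ∀ᵐ ω ∂μ, Y ω ∈ s) :
    ∀ᵐ ω ∂μ, ∀ᵐ y ∂condDistrib Y X μ (X ω), y ∈ s := by
  have h1 : ∀ᵐ z ∂(μ.map X) ⊗ₘ condDistrib Y X μ, z.2 ∈ s := by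
    rw [compProd_map_condDistrib hY.aemeasurable,
      ae_map_iff (hX.prodMk hY).aemeasurable (measurable_snd hs)]
    exact h
  exact ae_of_ae_map hX.aemeasurable (Measure.ae_ae_of_ae_compProd h1)

/-- One step of a locally polarizing martingale multiplies the expected potential by at most
`1 - δ`. -/
theorem integral_polarPotential_comp_le {Ω : Type*} [MeasurableSpace Ω] {μ : Measure Ω}
    [IsProbabilityMeasure μ] {X Y : Ω → ℝ} (hXm : Measurable X) (hYm : Measurable Y)
    (hX : ∀ᵐ ω ∂μ, X ω ∈ Icc (0 : ℝ) 1) (hY : ∀ᵐ ω ∂μ, Y ω ∈ Icc (0 : ℝ) 1)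
    (hmart : μ[Y | sigmaOf X] =ᵐ[μ] X)
    {α c t s p δ : ℝ} (hc : 0 < c) (hp : 0 < p) (hp1 : p ≤ 1) (hδ : 0 ≤ δ)
    (hK : 0 ≤ 1 - p - c ^ (-p)) (hδK : 2 * δ ≤ α * (1 - p - c ^ (-p))) (hδs : 2 * δ ≤ s)
    (hmid : ∀ᵐ ω ∂μ, X ω ∈ Ioo (min t (1 / 2)) (1 - min t (1 / 2)) →
      s ≤ (μ[fun ω' => (Y ω' - X ω') ^ 2 | sigmaOf X]) ω)
    (hlow : ∀ᵐ ω ∂μ, X ω ≤ t →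
      α ≤ (μ[indicator {ω' | Y ω' ≤ X ω' / c} (fun _ => (1 : ℝ)) | sigmaOf X]) ω)
    (hhigh : ∀ᵐ ω ∂μ, 1 - X ω ≤ t →
      α ≤ (μ[indicator {ω' | 1 - Y ω' ≤ (1 - X ω') / c} (fun _ => (1 : ℝ)) | sigmaOf X]) ω) :
    ∫ ω, polarPotential p (Y ω) ∂μ ≤ (1 - δ) * ∫ ω, polarPotential p (X ω) ∂μ := by
  have hφ := measurable_polarPotential p
  have hYint : Integrable Y μ := .of_mem_Icc 0 1 hYm.aemeasurable hY
  have hφX : Integrable (fun ω => polarPotential p (X ω)) μ :=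
    .of_mem_Icc 0 2 (hφ.comp hXm).aemeasurable
      (hX.mono fun ω hω => polarPotential_mem_Icc hp.le hω)
  have hφY : Integrable (fun ω => polarPotential p (Y ω)) μ :=
    .of_mem_Icc 0 2 (hφ.comp hYm).aemeasurable
      (hY.mono fun ω hω => polarPotential_mem_Icc hp.le hω)
  have hsq : Integrable (fun ω => (Y ω - X ω) ^ 2) μ :=
    .of_mem_Icc 0 1 (by fun_prop) (by
      filter_upwards [hX, hY] with ω h1 h2
      have := h1.1; have := h1.2; have := h2.1; have := h2.2
      constructor <;> nlinarith)
  have e1 : μ[Y | sigmaOf X] =ᵐ[μ] _ := condExp_ae_eq_integral_condDistrib' hXm hYint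
  have e2 : μ[fun ω => (Y ω - X ω) ^ 2 | sigmaOf X] =ᵐ[μ] _ :=
    condExp_prod_ae_eq_integral_condDistrib (f := fun z : ℝ × ℝ => (z.2 - z.1) ^ 2)
      hXm hYm.aemeasurable (by fun_prop : Measurable _).stronglyMeasurable hsq
  have e3 := condExp_indicator_ae_eq_condDistrib (μ := μ) hXm hYm
    (S := {z | z.2 ≤ z.1 / c}) (measurableSet_le (by fun_prop) (by fun_prop))
  have e4 := condExp_indicator_ae_eq_condDistrib (μ := μ) hXm hYm
    (S := {z | 1 - z.2 ≤ (1 - z.1) / c}) (measurableSet_le (by fun_prop) (by fun_prop))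
  have e5 : μ[fun ω => polarPotential p (Y ω) | sigmaOf X] =ᵐ[μ] _ :=
    condExp_ae_eq_integral_condDistrib hXm hYm.aemeasurable hφ.stronglyMeasurable hφY
  have hle : μ[fun ω => polarPotential p (Y ω) | sigmaOf X]
      ≤ᵐ[μ] fun ω => (1 - δ) * polarPotential p (X ω) := by
    filter_upwards [e1, e2, e3, e4, e5, hX, ae_ae_condDistrib hXm hYm measurableSet_Icc hY,
      hmart, hmid, hlow, hhigh] with ω e1 e2 e3 e4 e5 hX hν hmart hmid hlow hhigh
    rw [e5]
    refine integral_polarPotential_le _ hX hν (e1.symm.trans hmart) (t := t) hc hp hp1 hδ hK hδK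
      hδs (fun h => (hmid h).trans_eq e2) (fun h => (hlow h).trans_eq e3)
      (fun h => (hhigh h).trans_eq e4)
  have hsub : sigmaOf X ≤ (inferInstance : MeasurableSpace Ω) := hXm.comap_le
  rw [← integral_condExp hsub, ← integral_const_mul]
  exact integral_mono_ae integrable_condExp (hφX.const_mul _) hle

/-- With suction factor `c = exp (2 * (1 + 4 * L / α))` and small exponents `p`, the suction gain
`α * (1 - p - c ^ (-p))` is at least `4 * p * L`. -/
theorem le_mul_one_sub_sub_exp_rpow {α L p : ℝ} (hα : 0 < α) (hp : 0 ≤ p)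
    (hpl : p * (2 * (1 + 4 * L / α)) ≤ 1) (hL : 0 ≤ L) :
    4 * p * L ≤ α * (1 - p - exp (2 * (1 + 4 * L / α)) ^ (-p)) := by
  have h1 : exp (2 * (1 + 4 * L / α)) ^ (-p) ≤ 1 - p * (1 + 4 * L / α) := by
    rw [← exp_mul]
    set y := p * (2 * (1 + 4 * L / α)) with hy
    have hy0 : 0 ≤ y := by positivity
    have h3 : exp (-y) ≤ 1 - y / 2 := by
      rw [exp_neg]
      refine inv_le_of_inv_le₀ (by linarith) ?_
      have h4 : (1 - y / 2)⁻¹ ≤ 1 + y := by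
        rw [inv_le_iff_one_le_mul₀ (by linarith)]
        nlinarith
      linarith [add_one_le_exp y]
    have e : 2 * (1 + 4 * L / α) * -p = -y := by rw [hy]; ring
    rw [e]
    refine h3.trans_eq ?_
    rw [hy]
    ring
  have h2 : p * (4 * L / α) ≤ 1 - p - exp (2 * (1 + 4 * L / α)) ^ (-p) := by linarith
  calc 4 * p * L = α * (p * (4 * L / α)) := by field_simp
    _ ≤ _ := by gcongr

/-- **Theorem (local polarization implies strong polarization).** If a `[0,1]`-martingale
`X₀, X₁, …` (a martingale w.r.t. its natural filtration, with values in `[0,1]`) is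
`(α, τ(·), θ(·))`-locally polarizing for some `α > 0` and functions `τ, θ` positive on
positive arguments, then it is strongly polarizing: for every `γ > 0` there are `η < 1` and
`β < ∞` with `P(γ^t < X_t < 1 − γ^t) < β · η^t` for all `t`. -/
theorem local_polarization_implies_strong_polarization
    {Ω : Type*} [m0 : MeasurableSpace Ω] (μ : Measure Ω) [IsProbabilityMeasure μ]
    (X : ℕ → Ω → ℝ) (hXmeas : ∀ t, StronglyMeasurable (X t))
    (hmart : Martingale X (MeasureTheory.Filtration.natural X hXmeas) μ)
    (hbdd : ∀ t, ∀ᵐ ω ∂μ, X t ω ∈ Set.Icc (0 : ℝ) 1)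
    (α : ℝ) (τ θ : ℝ → ℝ)
    (hloc : LocallyPolarizing μ X α τ θ) :
    ∀ γ : ℝ, 0 < γ →
      ∃ η : ℝ, 0 ≤ η ∧ η < 1 ∧ ∃ β : ℝ, 0 ≤ β ∧
        ∀ t : ℕ, (μ {ω | γ ^ t < X t ω ∧ X t ω < 1 - γ ^ t}).toReal < β * η ^ t := by
  intro γ hγ
  obtain ⟨hα, hvar, hsuc⟩ := hloc
  rcases le_or_gt 1 γ with hγ1 | hγ1
  · refine ⟨1 / 2, by norm_num, by norm_num, 1, zero_le_one, fun t => ?_⟩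
    have h : {ω | γ ^ t < X t ω ∧ X t ω < 1 - γ ^ t} = ∅ := by
      refine eq_empty_of_forall_notMem fun ω hω => ?_
      have := one_le_pow₀ hγ1 (n := t)
      have h1 := hω.1
      have h2 := hω.2
      linarith
    rw [h, measure_empty, ENNReal.toReal_zero]
    positivity
  set L := -log γ with hLdef
  have hL : 0 < L := neg_pos.2 (log_neg hγ hγ1)
  set l := 2 * (1 + 4 * L / α) with hl
  have hl0 : 0 < l := by positivity
  set c := exp l with hcdef
  have hc : 0 < c := exp_pos l
  obtain ⟨hτ, hlow, hhigh⟩ := hsuc c hc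
  obtain ⟨hθ, hmid⟩ := hvar (min (τ c) (1 / 2)) (lt_min hτ (by norm_num))
  set s := θ (min (τ c) (1 / 2))
  set p := min 1 (min (1 / l) (s / (4 * L))) with hpdef
  have hp : 0 < p := lt_min one_pos (lt_min (by positivity) (by positivity))
  have hp1 : p ≤ 1 := min_le_left _ _
  have hpl : p * l ≤ 1 := by
    rw [← le_div_iff₀ hl0]
    exact (min_le_right _ _).trans (min_le_left _ _)
  have hps : 4 * p * L ≤ s := by
    have h : p ≤ s / (4 * L) := (min_le_right _ _).trans (min_le_right _ _)
    rw [le_div_iff₀ (by positivity)] at h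
    linarith
  have hKα : 4 * p * L ≤ α * (1 - p - c ^ (-p)) := le_mul_one_sub_sub_exp_rpow hα hp.le hpl hL.le
  have hK : 0 ≤ 1 - p - c ^ (-p) :=
    nonneg_of_mul_nonneg_right ((by positivity : 0 ≤ 4 * p * L).trans hKα) hα
  have hcond : ∀ j, μ[X (j + 1) | sigmaOf (X j)] =ᵐ[μ] X j := by
    intro j
    have hle : sigmaOf (X j) ≤ Filtration.natural X hXmeas j :=
      ((hmart.1 j).measurable).comap_le
    have h1 := condExp_condExp_of_le (μ := μ) (f := X (j + 1)) hle
      ((Filtration.natural X hXmeas).le j)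
    have h2 := condExp_congr_ae (m := sigmaOf (X j)) (hmart.2 j (j + 1) j.le_succ)
    have h3 : μ[X j | sigmaOf (X j)] = X j :=
      condExp_of_stronglyMeasurable (hle.trans ((Filtration.natural X hXmeas).le j))
        (comap_measurable (X j)).stronglyMeasurable (hmart.integrable j)
    exact h1.symm.trans (h2.trans (.of_eq h3))
  have hstep : ∀ j, ∫ ω, polarPotential p (X (j + 1) ω) ∂μ
      ≤ (1 - 2 * p * L) * ∫ ω, polarPotential p (X j ω) ∂μ := fun j =>
    integral_polarPotential_comp_le (hXmeas j).measurable (hXmeas (j + 1)).measurable (hbdd j)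
      (hbdd (j + 1)) (hcond j) hc hp hp1 (by positivity) hK (by linarith)
      (by linarith : 2 * (2 * p * L) ≤ s) (hmid j) (hlow j) (hhigh j)
  have hφ0 : ∀ j, ∀ᵐ ω ∂μ, polarPotential p (X j ω) ∈ Icc (0 : ℝ) 2 := fun j =>
    (hbdd j).mono fun ω hω => polarPotential_mem_Icc hp.le hω
  have hφint : ∀ j, Integrable (fun ω => polarPotential p (X j ω)) μ := fun j =>
    .of_mem_Icc 0 2 ((measurable_polarPotential p).comp (hXmeas j).measurable).aemeasurable (hφ0 j)
  set η := exp (-(p * L)) with hη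
  have hη1 : 1 - 2 * p * L ≤ η ^ 2 := by
    rw [hη, ← exp_nat_mul]
    have := add_one_le_exp ((2 : ℕ) * -(p * L))
    push_cast at this ⊢
    linarith
  have hdecay : ∀ j, ∫ ω, polarPotential p (X j ω) ∂μ ≤ 2 * (η ^ 2) ^ j := by
    intro j
    induction j with
    | zero =>
      have := integral_mono_ae (hφint 0) (integrable_const (2 : ℝ)) ((hφ0 0).mono fun ω h => h.2)
      simpa using this
    | succ j ih =>
      have h0 : 0 ≤ ∫ ω, polarPotential p (X j ω) ∂μ :=
        integral_nonneg_of_ae ((hφ0 j).mono fun ω h => h.1)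
      calc _ ≤ (1 - 2 * p * L) * ∫ ω, polarPotential p (X j ω) ∂μ := hstep j
        _ ≤ η ^ 2 * (2 * (η ^ 2) ^ j) := by gcongr
        _ = 2 * (η ^ 2) ^ (j + 1) := by ring
  have hηγ : η = γ ^ p := by
    rw [hη, rpow_def_of_pos hγ, hLdef]
    ring_nf
  have hη0 : 0 < η := exp_pos _
  refine ⟨η, hη0.le, exp_lt_one_iff.2 (neg_lt_zero.2 (by positivity)), 3, by norm_num, fun t => ?_⟩
  have hsub : μ.real {ω | γ ^ t < X t ω ∧ X t ω < 1 - γ ^ t}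
      ≤ μ.real {ω | η ^ t ≤ polarPotential p (X t ω)} := by
    refine measureReal_mono fun ω hω => ?_
    have hγt : 0 < γ ^ t := by positivity
    obtain ⟨h1, h2⟩ := hω
    have h3 : (γ ^ t) ^ p ≤ min (X t ω) (1 - X t ω) ^ p :=
      rpow_le_rpow hγt.le (le_min h1.le (by linarith)) hp.le
    have h4 : (γ ^ t) ^ p = η ^ t := by
      rw [hηγ, ← rpow_natCast, ← rpow_mul hγ.le, mul_comm, rpow_mul hγ.le, rpow_natCast]
    have h5 : 0 ≤ X t ω * (1 - X t ω) := mul_nonneg (by linarith) (by linarith)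
    rw [h4] at h3
    rw [mem_ofPred_eq, polarPotential]
    linarith
  have hmarkov := mul_meas_ge_le_integral_of_nonneg ((hφ0 t).mono fun ω h => h.1) (hφint t) (η ^ t)
  have hηt : 0 < η ^ t := by positivity
  have h2 : η ^ t * μ.real {ω | η ^ t ≤ polarPotential p (X t ω)} ≤ η ^ t * (2 * η ^ t) :=
    hmarkov.trans ((hdecay t).trans_eq (by ring))
  have h3 := hsub.trans (le_of_mul_le_mul_left h2 hηt)
  change μ.real _ < _
  linarith
end

section
/- Let X and Y be arbitrary discrete random variables with ranges 𝒳 and 𝒴 respectively. Then there exists a function X̂ : 𝒴 → 𝒳 such that Pr[X ≠ X̂(Y)] ≤ H(X | Y), where H(X|Y) is the conditional Shannon entropy in bits. In particular, the maximum a posteriori estimator X̂(y) := argmax_x Pr[X = x | Y = y] satisfies this bound. -/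
open MeasureTheory ProbabilityTheory Real Finset

/-- The probability mass that the random variable `X` puts on the value `a`. -/
noncomputable def massOf {Ω : Type*} [MeasurableSpace Ω] (μ : Measure Ω)
    {S : Type*} (X : Ω → S) (a : S) : ℝ :=
  (μ (X ⁻¹' {a})).toReal

/-- Shannon entropy (in bits) of a random variable with values in a finite type. -/
noncomputable def entropy {Ω : Type*} [MeasurableSpace Ω] (μ : Measure Ω)
    {S : Type*} [Fintype S] (X : Ω → S) : ℝ :=
  (∑ a : S, Real.negMulLog (massOf μ X a)) / Real.log 2

/-- Conditional Shannon entropy (in bits) `H(X | Y)`. -/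
noncomputable def condEntropy {Ω : Type*} [MeasurableSpace Ω] (μ : Measure Ω)
    {S T : Type*} [Fintype S] [Fintype T] (X : Ω → S) (Y : Ω → T) : ℝ :=
  ∑ b : T, massOf μ Y b * entropy (μ[|Y ⁻¹' {b}]) X

/-- Normalized (`q`-ary) entropy `H̄(X) = H(X) / log₂ q`. -/
noncomputable def nEntropy {Ω : Type*} [MeasurableSpace Ω] (μ : Measure Ω)
    {S : Type*} [Fintype S] (X : Ω → S) : ℝ :=
  entropy μ X / Real.logb 2 (Fintype.card S)

/-- Normalized conditional entropy `H̄(X|Y) = H(X|Y) / log₂ q`. -/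
noncomputable def nCondEntropy {Ω : Type*} [MeasurableSpace Ω] (μ : Measure Ω)
    {S T : Type*} [Fintype S] [Fintype T] (X : Ω → S) (Y : Ω → T) : ℝ :=
  condEntropy μ X Y / Real.logb 2 (Fintype.card S)

/-- Distinct outcomes of a probability vector, the first at most as likely as the second: the
first has probability at most one half. -/
lemma le_half_of_sum_eq_one {S : Type*} [Fintype S] {p : S → ℝ} (hp : ∀ a, 0 ≤ p a)
    (hsum : ∑ a, p a = 1) {a s : S} (has : a ≠ s) (hle : p a ≤ p s) : p a ≤ 1 / 2 := by
  classical
  have h : ∑ x ∈ {a, s}, p x ≤ ∑ x, p x :=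
    Finset.sum_le_sum_of_subset_of_nonneg (Finset.subset_univ _) fun x _ _ => hp x
  rw [Finset.sum_pair has, hsum] at h
  linarith

lemma mul_log_two_le_negMulLog {x : ℝ} (hx : 0 ≤ x) (hx' : x ≤ 1 / 2) :
    x * Real.log 2 ≤ Real.negMulLog x := by
  rcases hx.eq_or_lt with rfl | hpos
  · simp
  · have h := Real.log_le_log hpos hx'
    rw [one_div, Real.log_inv] at h
    rw [Real.negMulLog]
    nlinarith

lemma one_sub_mul_log_two_le_sum_negMulLog {S : Type*} [Fintype S] {p : S → ℝ}
    (hp : ∀ a, 0 ≤ p a) (hsum : ∑ a, p a = 1) {s : S} (hs : ∀ a, p a ≤ p s) :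
    (1 - p s) * Real.log 2 ≤ ∑ a, Real.negMulLog (p a) := by
  classical
  have hsum' := Finset.add_sum_erase Finset.univ p (Finset.mem_univ s)
  have hps : p s ≤ 1 := hsum ▸ Finset.single_le_sum (fun a _ => hp a) (Finset.mem_univ s)
  rw [hsum] at hsum'
  rw [← Finset.add_sum_erase Finset.univ _ (Finset.mem_univ s), ← hsum', add_sub_cancel_left,
    Finset.sum_mul]
  refine le_add_of_nonneg_of_le (Real.negMulLog_nonneg (hp s) hps) (Finset.sum_le_sum fun a ha => ?_)
  exact mul_log_two_le_negMulLog (hp a)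
    (le_half_of_sum_eq_one hp hsum (Finset.ne_of_mem_erase ha) (hs a))

lemma massOf_nonneg {Ω : Type*} [MeasurableSpace Ω] (μ : Measure Ω) {S : Type*} (X : Ω → S)
    (a : S) : 0 ≤ massOf μ X a :=
  ENNReal.toReal_nonneg

lemma sum_massOf {Ω : Type*} [MeasurableSpace Ω] (μ : Measure Ω) [IsProbabilityMeasure μ]
    {S : Type*} [Fintype S] [MeasurableSpace S] [MeasurableSingletonClass S]
    {X : Ω → S} (hX : Measurable X) : ∑ a, massOf μ X a = 1 := by
  have h := sum_measure_preimage_singleton (μ := μ) (f := X) Finset.univ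
    fun a _ => hX (measurableSet_singleton a)
  simp only [massOf]
  rw [← ENNReal.toReal_sum fun a _ => measure_ne_top μ _, h]
  simp

/-- The error probability of the best constant guess of `X` is at most the entropy of `X`. -/
lemma measure_ne_le_entropy {Ω : Type*} [MeasurableSpace Ω] (μ : Measure Ω)
    [IsProbabilityMeasure μ] {S : Type*} [Fintype S] [MeasurableSpace S]
    [MeasurableSingletonClass S] {X : Ω → S} (hX : Measurable X) {s : S}
    (hs : ∀ a, massOf μ X a ≤ massOf μ X s) :
    (μ {ω | X ω ≠ s}).toReal ≤ entropy μ X := by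
  have hcompl : (μ {ω | X ω ≠ s}).toReal = 1 - massOf μ X s :=
    probReal_compl_eq_one_sub (hX (measurableSet_singleton s))
  rw [hcompl, entropy, le_div_iff₀ (Real.log_pos one_lt_two)]
  exact one_sub_mul_log_two_le_sum_negMulLog (massOf_nonneg μ X) (sum_massOf μ hX) hs

/-- The error probability of an estimator, decomposed along the values of the observation. -/
lemma measure_ne_comp_eq_sum {Ω : Type*} [MeasurableSpace Ω] (μ : Measure Ω) [IsFiniteMeasure μ]
    {S T : Type*} [Fintype T] [MeasurableSpace T] [MeasurableSingletonClass T]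
    (X : Ω → S) {Y : Ω → T} (hY : Measurable Y) (g : T → S) :
    (μ {ω | X ω ≠ g (Y ω)}).toReal =
      ∑ b, massOf μ Y b * ((μ[|Y ⁻¹' {b}]) {ω | X ω ≠ g b}).toReal := by
  have hb (b : T) : (μ[|Y ⁻¹' {b}]) {ω | X ω ≠ g (Y ω)} = (μ[|Y ⁻¹' {b}]) {ω | X ω ≠ g b} := by
    have hm := hY (measurableSet_singleton b)
    rw [← cond_inter_self hm, ← cond_inter_self hm {ω | X ω ≠ g b}]
    congr 1
    ext ω
    simp +contextual
  conv_lhs => rw [← sum_meas_smul_cond_fiber hY μ]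
  simp only [Measure.coe_finsetSum, Finset.sum_apply, Measure.smul_apply, smul_eq_mul, hb]
  rw [ENNReal.toReal_sum fun b _ => ENNReal.mul_ne_top (measure_ne_top _ _) (measure_ne_top _ _)]
  simp only [ENNReal.toReal_mul, massOf]

/-- **Lemma (maximum a posteriori estimation).** For discrete random variables `X, Y` there
is an estimator `X̂ : 𝒴 → 𝒳` with `Pr[X ≠ X̂(Y)] ≤ H(X|Y)`; in particular, any maximum a
posteriori estimator (i.e. any `g` with `g y` a most likely value of `X` given `Y = y`)
satisfies this bound. -/
theorem map_estimator_error_le_condEntropy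
    {Ω : Type*} [MeasurableSpace Ω] (μ : Measure Ω) [IsProbabilityMeasure μ]
    {S T : Type*} [Fintype S] [Nonempty S] [Fintype T]
    [MeasurableSpace S] [MeasurableSingletonClass S]
    [MeasurableSpace T] [MeasurableSingletonClass T]
    (X : Ω → S) (Y : Ω → T) (hX : Measurable X) (hY : Measurable Y) :
    (∃ Xhat : T → S, (μ {ω | X ω ≠ Xhat (Y ω)}).toReal ≤ condEntropy μ X Y) ∧
    (∀ g : T → S,
      (∀ y : T, ∀ x : S, massOf (μ[|Y ⁻¹' {y}]) X x ≤ massOf (μ[|Y ⁻¹' {y}]) X (g y)) →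
      (μ {ω | X ω ≠ g (Y ω)}).toReal ≤ condEntropy μ X Y) := by
  have map_bound : ∀ g : T → S,
      (∀ y : T, ∀ x : S, massOf (μ[|Y ⁻¹' {y}]) X x ≤ massOf (μ[|Y ⁻¹' {y}]) X (g y)) →
      (μ {ω | X ω ≠ g (Y ω)}).toReal ≤ condEntropy μ X Y := by
    intro g hg
    rw [measure_ne_comp_eq_sum μ X hY g, condEntropy]
    refine Finset.sum_le_sum fun b _ => ?_
    by_cases h0 : μ (Y ⁻¹' {b}) = 0
    · simp [massOf, h0]
    · have := cond_isProbabilityMeasure h0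
      exact mul_le_mul_of_nonneg_left (measure_ne_le_entropy _ hX (hg b)) (massOf_nonneg μ Y b)
  choose g hg using fun y : T => Finite.exists_max (massOf (μ[|Y ⁻¹' {y}]) X)
  exact ⟨⟨g, map_bound g hg⟩, map_bound⟩
end

section
/- There exists a universal constant C such that the following holds. If X ∈ F_q is a random variable with distribution D_X, then d₂(D_X, U)²/(2·log₂ q) ≤ 1 − H̄(X) ≤ C·q·d₂(D_X, U)², where U is the uniform distribution over F_q and d₂(D₁, D₂) := (Σ_{x ∈ F_q} (D₁(x) − D₂(x))²)^{1/2}. -/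
open MeasureTheory ProbabilityTheory Real Finset

/-- Pointwise quadratic lower bound for the relative entropy integrand on `[0, 1]`. -/
theorem half_sq_sub_le_mul_log_sub {p u : ℝ} (hp : 0 ≤ p) (hp1 : p ≤ 1) (hu : 0 < u)
    (hu1 : u ≤ 1) : (p - u) ^ 2 / 2 ≤ p * (log p - log u) - p + u := by
  rcases hp.eq_or_lt with rfl | hp
  · nlinarith
  rcases le_total u p with hup | hpu
  · have hlog := Real.le_log_one_add_of_nonneg (x := (p - u) / u)
      (div_nonneg (sub_nonneg.2 hup) hu.le)
    have hx : 1 + (p - u) / u = p / u := by field_simp; ring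
    have hy : 2 * ((p - u) / u) / ((p - u) / u + 2) = 2 * (p - u) / (p + u) := by
      have : (p - u) / u + 2 = (p + u) / u := by field_simp; ring
      rw [this]
      field_simp
    rw [hx, hy, log_div hp.ne' hu.ne'] at hlog
    have hmul := mul_le_mul_of_nonneg_left hlog hp.le
    have hid : p * (2 * (p - u) / (p + u)) - p + u = (p - u) ^ 2 / (p + u) := by
      field_simp; ring
    have hdiv : (p - u) ^ 2 / 2 ≤ (p - u) ^ 2 / (p + u) := by
      gcongr
      linarith
    linarith
  · have hlog : log (u / p) ≤ sinh (log (u / p)) :=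
      Real.self_le_sinh_iff.2 (log_nonneg ((one_le_div hp).2 hpu))
    rw [Real.sinh_log (div_pos hu hp), log_div hu.ne' hp.ne'] at hlog
    have hmul := mul_le_mul_of_nonneg_left hlog hp.le
    have hid : u - p - p * ((u / p - (u / p)⁻¹) / 2) = (p - u) ^ 2 / (2 * u) := by
      field_simp; ring
    have hdiv : (p - u) ^ 2 / 2 ≤ (p - u) ^ 2 / (2 * u) := by
      gcongr
      linarith
    linarith

/-- Pointwise bound of the relative entropy integrand by the `χ²` integrand. -/
theorem mul_log_sub_le_mul_div_sub_one {p u : ℝ} (hp : 0 ≤ p) (hu : 0 < u) :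
    p * (log p - log u) ≤ p * (p / u - 1) := by
  rcases hp.eq_or_lt with rfl | hp
  · simp
  rw [← log_div hp.ne' hu.ne']
  exact mul_le_mul_of_nonneg_left (log_le_sub_one_of_pos (div_pos hp hu)) hp.le

theorem sum_massOf_eq_one {Ω S : Type*} [MeasurableSpace Ω] [Fintype S] [MeasurableSpace S]
    [MeasurableSingletonClass S] (μ : Measure Ω) [IsProbabilityMeasure μ] {X : Ω → S}
    (hX : Measurable X) : ∑ a : S, massOf μ X a = 1 := by
  have h := sum_measureReal_preimage_singleton (μ := μ) (f := X) (univ : Finset S)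
    (fun y _ => hX (measurableSet_singleton y))
  simpa [massOf, Measure.real] using h

theorem one_sub_nEntropy_eq {Ω S : Type*} [MeasurableSpace Ω] [Fintype S]
    (μ : Measure Ω) (X : Ω → S) (hS : 1 < Fintype.card S) (hsum : ∑ a : S, massOf μ X a = 1) :
    1 - nEntropy μ X =
      (∑ a : S, massOf μ X a * (log (massOf μ X a) - log (Fintype.card S : ℝ)⁻¹)) /
        log (Fintype.card S) := by
  have hq : 0 < log (Fintype.card S : ℝ) := log_pos (by exact_mod_cast hS)
  have h2 : 0 < log (2 : ℝ) := log_pos one_lt_two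
  have hnum : ∑ a : S, massOf μ X a * (log (massOf μ X a) - log (Fintype.card S : ℝ)⁻¹) =
      log (Fintype.card S) - ∑ a : S, negMulLog (massOf μ X a) := by
    simp only [log_inv, sub_neg_eq_add, mul_add, sum_add_distrib, ← sum_mul, hsum, negMulLog,
      neg_mul, sum_neg_distrib]
    ring
  rw [hnum, nEntropy, entropy, logb]
  field_simp

/-- **Lemma (entropy gap vs. `L²` distance to uniform).** There is a universal constant `C`
such that for any random variable `X` with values in a finite field `F_q`,
`d₂(D_X, U)² / (2 log₂ q) ≤ 1 − H̄(X) ≤ C · q · d₂(D_X, U)²`, where `U` is the uniform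
distribution on `F_q` and `d₂` is the `L²` distance between distributions. -/
theorem entropy_gap_l2_comparable :
    ∃ C : ℝ, 0 < C ∧
      ∀ (F : Type) [Field F] [Fintype F] [MeasurableSpace F] [MeasurableSingletonClass F]
        (Ω : Type) [MeasurableSpace Ω] (μ : Measure Ω) [IsProbabilityMeasure μ]
        (X : Ω → F), Measurable X →
        (∑ x : F, (massOf μ X x - ((Fintype.card F : ℝ))⁻¹) ^ 2) /
            (2 * Real.logb 2 (Fintype.card F)) ≤ 1 - nEntropy μ X ∧
        1 - nEntropy μ X ≤
          C * (Fintype.card F : ℝ) *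
            ∑ x : F, (massOf μ X x - ((Fintype.card F : ℝ))⁻¹) ^ 2 := by
  refine ⟨(log 2)⁻¹, inv_pos.2 (log_pos one_lt_two), ?_⟩
  intro F _ _ _ _ Ω _ μ _ X hX
  have hcard : 1 < Fintype.card F := Fintype.one_lt_card
  have hsum := sum_massOf_eq_one μ hX
  rw [one_sub_nEntropy_eq μ X hcard hsum]
  have hp0 : ∀ x, 0 ≤ massOf μ X x := fun x => ENNReal.toReal_nonneg
  have hp1 : ∀ x, massOf μ X x ≤ 1 := fun x => measureReal_le_one
  have hq2 : (2 : ℝ) ≤ Fintype.card F := by exact_mod_cast hcard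
  have hsumu : ∑ _x : F, (Fintype.card F : ℝ)⁻¹ = 1 := by
    rw [sum_const, card_univ, nsmul_eq_mul]
    exact mul_inv_cancel₀ (by positivity)
  generalize massOf μ X = p at *
  generalize (Fintype.card F : ℝ) = q at *
  have hq : 0 < q := by linarith
  have hu : 0 < q⁻¹ := inv_pos.2 hq
  have h2 : 0 < log (2 : ℝ) := log_pos one_lt_two
  have hlog : log 2 ≤ log q := log_le_log two_pos hq2
  have hlogq : 0 < log q := h2.trans_le hlog
  have hlower : (∑ x, (p x - q⁻¹) ^ 2) / 2 ≤ ∑ x, p x * (log (p x) - log q⁻¹) := by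
    calc (∑ x, (p x - q⁻¹) ^ 2) / 2 = ∑ x, (p x - q⁻¹) ^ 2 / 2 := sum_div ..
      _ ≤ ∑ x, (p x * (log (p x) - log q⁻¹) - p x + q⁻¹) :=
        sum_le_sum fun x _ => half_sq_sub_le_mul_log_sub (hp0 x) (hp1 x) hu
          (inv_le_one_of_one_le₀ (by linarith))
      _ = ∑ x, p x * (log (p x) - log q⁻¹) := by
        rw [sum_add_distrib, sum_sub_distrib, hsum, hsumu]
        ring
  have hupper : ∑ x, p x * (log (p x) - log q⁻¹) ≤ q * ∑ x, (p x - q⁻¹) ^ 2 := by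
    calc ∑ x, p x * (log (p x) - log q⁻¹) ≤ ∑ x, p x * (p x / q⁻¹ - 1) :=
        sum_le_sum fun x _ => mul_log_sub_le_mul_div_sub_one (hp0 x) hu
      _ = ∑ x, (q * (p x - q⁻¹) ^ 2 + p x - q⁻¹) :=
        sum_congr rfl fun x _ => by field_simp; ring
      _ = q * ∑ x, (p x - q⁻¹) ^ 2 := by
        rw [sum_sub_distrib, sum_add_distrib, hsum, hsumu, mul_sum]
        ring
  have hd : 0 ≤ ∑ x, (p x - q⁻¹) ^ 2 := sum_nonneg fun x _ => sq_nonneg _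
  generalize ∑ x, (p x - q⁻¹) ^ 2 = d at *
  constructor
  · have hl1 : log (2 : ℝ) ≤ 1 := by linarith [log_two_lt_d9]
    calc d / (2 * logb 2 q) = (d / 2 * log 2) / log q := by
          rw [logb]; field_simp
      _ ≤ _ := by
        gcongr
        nlinarith
  · calc _ ≤ q * d / log q := by gcongr
      _ ≤ q * d / log 2 := by gcongr
      _ = (log 2)⁻¹ * q * d := by ring
end

section
/- For every finite field F_q and every γ > 0 there exists τ > 0 such that the following holds: if (X₁, A₁) and (X₂, A₂) are independent pairs of random variables with X₁, X₂ ∈ F_q (A₁, A₂ arbitrary discrete random variables), and if 1 − H̄(X₁ | A₁) ≤ τ and 1 − H̄(X₂ | A₂) ≤ τ, then 1 − H̄(X₁ + X₂ | A₁, A₂) ≤ γ·(1 − H̄(X₁ | A₁)). -/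
open MeasureTheory ProbabilityTheory Real Finset

/-- The divergence (in nats) of the weights `p` from the uniform distribution. -/
noncomputable def uniformDivergence {S : Type*} [Fintype S] (p : S → ℝ) : ℝ :=
  Real.log (Fintype.card S) - ∑ a, Real.negMulLog (p a)

lemma sq_sub_le_four_mul_divergence_term {x u : ℝ} (hx : 0 ≤ x) (hx1 : x ≤ 1)
    (hu : 0 < u) (hu1 : u ≤ 1) :
    (x - u) ^ 2 ≤ 4 * (x * Real.log x - x * Real.log u - x + u) := by
  rcases hx.eq_or_lt with rfl | hx
  · simp
    nlinarith
  obtain ⟨s, hs, rfl⟩ : ∃ s : ℝ, 0 < s ∧ s ^ 2 = x :=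
    ⟨√x, Real.sqrt_pos.2 hx, Real.sq_sqrt hx.le⟩
  obtain ⟨t, ht, rfl⟩ : ∃ t : ℝ, 0 < t ∧ t ^ 2 = u :=
    ⟨√u, Real.sqrt_pos.2 hu, Real.sq_sqrt hu.le⟩
  have hs1 : s ≤ 1 := by nlinarith
  have ht1 : t ≤ 1 := by nlinarith
  have h := Real.log_le_sub_one_of_pos (div_pos ht hs)
  rw [Real.log_div ht.ne' hs.ne'] at h
  have h2 : s ^ 2 * (Real.log t - Real.log s) ≤ s * t - s ^ 2 := by
    calc _ ≤ s ^ 2 * (t / s - 1) := by gcongr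
      _ = _ := by field_simp
  have h3 : (s + t) ^ 2 ≤ 4 := by nlinarith
  have h4 : (s ^ 2 - t ^ 2) ^ 2 ≤ 4 * (s - t) ^ 2 := by
    nlinarith [mul_le_mul_of_nonneg_right h3 (sq_nonneg (s - t))]
  rw [Real.log_pow, Real.log_pow]
  push_cast
  nlinarith

lemma sum_sq_sub_inv_card_le_four_mul_uniformDivergence {S : Type*} [Fintype S] [Nonempty S]
    {p : S → ℝ} (hp : ∀ a, 0 ≤ p a) (hsum : ∑ a, p a = 1) :
    ∑ a, (p a - (Fintype.card S : ℝ)⁻¹) ^ 2 ≤ 4 * uniformDivergence p := by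
  have hq : (1 : ℝ) ≤ Fintype.card S := by exact_mod_cast Fintype.card_pos (α := S)
  calc _ ≤ ∑ a, 4 * (p a * Real.log (p a) - p a * Real.log (Fintype.card S : ℝ)⁻¹ - p a
        + (Fintype.card S : ℝ)⁻¹) := by
        refine Finset.sum_le_sum fun a _ => sq_sub_le_four_mul_divergence_term (hp a) ?_
          (by positivity) (inv_le_one_of_one_le₀ hq)
        exact hsum ▸ Finset.single_le_sum (fun b _ => hp b) (Finset.mem_univ a)
    _ = 4 * uniformDivergence p := by
        rw [← Finset.mul_sum, Finset.sum_add_distrib, Finset.sum_sub_distrib,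
          Finset.sum_sub_distrib, ← Finset.sum_mul, hsum]
        simp only [uniformDivergence, Real.negMulLog, neg_mul, Finset.sum_neg_distrib,
          Real.log_inv, Finset.sum_const, Finset.card_univ, nsmul_eq_mul]
        field_simp
        ring

lemma uniformDivergence_nonneg {S : Type*} [Fintype S] [Nonempty S]
    {p : S → ℝ} (hp : ∀ a, 0 ≤ p a) (hsum : ∑ a, p a = 1) : 0 ≤ uniformDivergence p := by
  have h := sum_sq_sub_inv_card_le_four_mul_uniformDivergence hp hsum
  have h' := Finset.sum_nonneg fun a (_ : a ∈ Finset.univ) =>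
    sq_nonneg (p a - (Fintype.card S : ℝ)⁻¹)
  linarith

lemma uniformDivergence_le_card_mul_sum_sq {S : Type*} [Fintype S] [Nonempty S]
    {p : S → ℝ} (hp : ∀ a, 0 ≤ p a) (hsum : ∑ a, p a = 1) :
    uniformDivergence p ≤ Fintype.card S * ∑ a, (p a - (Fintype.card S : ℝ)⁻¹) ^ 2 := by
  have hq : (0 : ℝ) < Fintype.card S := by exact_mod_cast Fintype.card_pos (α := S)
  have hterm : ∀ a, p a * Real.log (Fintype.card S) - Real.negMulLog (p a)
      ≤ Fintype.card S * p a ^ 2 - p a := by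
    intro a
    rcases (hp a).eq_or_lt with h | h
    · simp [← h]
    · have hl := Real.log_le_sub_one_of_pos (mul_pos hq h)
      rw [Real.log_mul hq.ne' h.ne'] at hl
      rw [Real.negMulLog]
      nlinarith [mul_le_mul_of_nonneg_left hl h.le]
  have hL : uniformDivergence p
      = ∑ a, (p a * Real.log (Fintype.card S) - Real.negMulLog (p a)) := by
    rw [Finset.sum_sub_distrib, ← Finset.sum_mul, hsum, one_mul, uniformDivergence]
  have hR : Fintype.card S * ∑ a, (p a - (Fintype.card S : ℝ)⁻¹) ^ 2
      = ∑ a, (Fintype.card S * p a ^ 2 - p a) := by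
    simp only [sub_sq, Finset.sum_add_distrib, Finset.sum_sub_distrib, ← Finset.sum_mul,
      ← Finset.mul_sum, hsum, Finset.sum_const, Finset.card_univ, nsmul_eq_mul]
    field_simp
    ring
  rw [hL, hR]
  exact Finset.sum_le_sum fun a _ => hterm a

lemma uniformDivergence_convolution_le {G : Type*} [AddCommGroup G] [Fintype G]
    {p r s : G → ℝ} (hp : ∀ a, 0 ≤ p a) (hpsum : ∑ a, p a = 1)
    (hr : ∀ a, 0 ≤ r a) (hrsum : ∑ a, r a = 1) (hs : ∀ c, s c = ∑ x, p x * r (c - x)) :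
    uniformDivergence s
      ≤ 16 * (Fintype.card G : ℝ) ^ 2 * (uniformDivergence p * uniformDivergence r) := by
  have hq : (0 : ℝ) < Fintype.card G := by exact_mod_cast Fintype.card_pos (α := G)
  have hshift : ∀ (f : G → ℝ) (c : G), ∑ x, f (c - x) = ∑ x, f x := fun f c =>
    Equiv.sum_comp (Equiv.subLeft c) f
  have hs0 : ∀ c, 0 ≤ s c := fun c => by
    rw [hs]
    exact Finset.sum_nonneg fun x _ => mul_nonneg (hp _) (hr _)
  have hssum : ∑ c, s c = 1 := by
    simp_rw [hs]
    rw [Finset.sum_comm]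
    simp_rw [← Finset.mul_sum]
    have : ∀ x, ∑ c, r (c - x) = 1 := fun x => by
      rw [← hrsum]
      exact Equiv.sum_comp (Equiv.subRight x) r
    simp [this, hpsum]
  have hpD := sum_sq_sub_inv_card_le_four_mul_uniformDivergence hp hpsum
  have hrD := sum_sq_sub_inv_card_le_four_mul_uniformDivergence hr hrsum
  have hpD0 := uniformDivergence_nonneg hp hpsum
  have hterm : ∀ c, (s c - (Fintype.card G : ℝ)⁻¹) ^ 2
      ≤ 16 * (uniformDivergence p * uniformDivergence r) := by
    intro c
    have he : s c - (Fintype.card G : ℝ)⁻¹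
        = ∑ x, (p x - (Fintype.card G : ℝ)⁻¹) * (r (c - x) - (Fintype.card G : ℝ)⁻¹) := by
      simp only [mul_sub, sub_mul, Finset.sum_sub_distrib, ← Finset.sum_mul, ← Finset.mul_sum,
        hpsum, hshift r c, hrsum, hs c, Finset.sum_const, Finset.card_univ, nsmul_eq_mul]
      field_simp
      ring
    rw [he]
    refine (Finset.sum_mul_sq_le_sq_mul_sq _ _ _).trans ?_
    rw [hshift (fun x => (r x - (Fintype.card G : ℝ)⁻¹) ^ 2) c]
    refine (mul_le_mul hpD hrD (Finset.sum_nonneg fun _ _ => sq_nonneg _)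
      (by positivity)).trans_eq ?_
    ring
  calc _ ≤ (Fintype.card G : ℝ) * ∑ c, (s c - (Fintype.card G : ℝ)⁻¹) ^ 2 :=
        uniformDivergence_le_card_mul_sum_sq hs0 hssum
    _ ≤ (Fintype.card G : ℝ)
          * ∑ _c : G, 16 * (uniformDivergence p * uniformDivergence r) := by
        gcongr with c _
        exact hterm c
    _ = _ := by
        rw [Finset.sum_const, Finset.card_univ, nsmul_eq_mul]
        ring

lemma massOf_cond {Ω : Type*} [MeasurableSpace Ω] (μ : Measure Ω)
    {S T : Type*} [MeasurableSpace T] [MeasurableSingletonClass T]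
    (X : Ω → S) {A : Ω → T} (hA : Measurable A) (x : S) (b : T) :
    massOf (μ[|A ⁻¹' {b}]) X x = (massOf μ A b)⁻¹ * massOf μ (fun ω => (X ω, A ω)) (x, b) := by
  rw [massOf, cond_apply (hA (measurableSet_singleton b)), ENNReal.toReal_mul,
    ENNReal.toReal_inv]
  congr 3
  ext ω
  simp [and_comm]

lemma sum_massOf_cond {Ω : Type*} [MeasurableSpace Ω] (μ : Measure Ω) [IsFiniteMeasure μ]
    {S T : Type*} [Fintype S] [MeasurableSpace S] [MeasurableSingletonClass S]
    {X : Ω → S} (hX : Measurable X) (A : Ω → T) {b : T} (hb : massOf μ A b ≠ 0) :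
    ∑ x, massOf (μ[|A ⁻¹' {b}]) X x = 1 := by
  have h : μ (A ⁻¹' {b}) ≠ 0 := fun h => hb (by simp [massOf, h])
  have := cond_isProbabilityMeasure h
  exact sum_massOf _ hX

lemma one_sub_nCondEntropy {Ω : Type*} [MeasurableSpace Ω] (μ : Measure Ω)
    [IsProbabilityMeasure μ] {S T : Type*} [Fintype S] [Nontrivial S] [Fintype T]
    [MeasurableSpace T] [MeasurableSingletonClass T]
    (X : Ω → S) {A : Ω → T} (hA : Measurable A) :
    1 - nCondEntropy μ X A
      = (∑ b, massOf μ A b * uniformDivergence (massOf (μ[|A ⁻¹' {b}]) X))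
        / Real.log (Fintype.card S) := by
  have hq : 0 < Real.log (Fintype.card S) :=
    Real.log_pos (by exact_mod_cast Fintype.one_lt_card)
  have h2 : 0 < Real.log 2 := Real.log_pos one_lt_two
  simp only [uniformDivergence, mul_sub, Finset.sum_sub_distrib, ← Finset.sum_mul,
    sum_massOf μ hA, nCondEntropy, condEntropy, entropy, Real.logb, mul_div_assoc']
  rw [← Finset.sum_div]
  field_simp

lemma massOf_pair_of_indepFun {Ω : Type*} [MeasurableSpace Ω] {μ : Measure Ω}
    {S T : Type*} [MeasurableSpace S] [MeasurableSingletonClass S]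
    [MeasurableSpace T] [MeasurableSingletonClass T] {X : Ω → S} {Y : Ω → T}
    (h : IndepFun X Y μ) (x : S) (y : T) :
    massOf μ (fun ω => (X ω, Y ω)) (x, y) = massOf μ X x * massOf μ Y y := by
  rw [massOf, massOf, massOf, ← ENNReal.toReal_mul,
    ← h.measure_inter_preimage_eq_mul _ _ (measurableSet_singleton x) (measurableSet_singleton y)]
  congr 2
  ext ω
  simp

lemma massOf_add_pair {Ω : Type*} [MeasurableSpace Ω] {μ : Measure Ω} [IsFiniteMeasure μ]
    {G T₁ T₂ : Type*} [AddCommGroup G] [Fintype G] [MeasurableSpace G]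
    [MeasurableSingletonClass G]
    [MeasurableSpace T₁] [MeasurableSingletonClass T₁]
    [MeasurableSpace T₂] [MeasurableSingletonClass T₂]
    {X₁ X₂ : Ω → G} {A₁ : Ω → T₁} {A₂ : Ω → T₂}
    (hX₁ : Measurable X₁) (hX₂ : Measurable X₂) (hA₁ : Measurable A₁) (hA₂ : Measurable A₂)
    (h : IndepFun (fun ω => (X₁ ω, A₁ ω)) (fun ω => (X₂ ω, A₂ ω)) μ)
    (c : G) (a : T₁) (b : T₂) :
    massOf μ (fun ω => (X₁ ω + X₂ ω, (A₁ ω, A₂ ω))) (c, (a, b))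
      = ∑ x, massOf μ (fun ω => (X₁ ω, A₁ ω)) (x, a)
          * massOf μ (fun ω => (X₂ ω, A₂ ω)) (c - x, b) := by
  simp_rw [← massOf_pair_of_indepFun h]
  have hset : (fun ω => (X₁ ω + X₂ ω, (A₁ ω, A₂ ω))) ⁻¹' {(c, (a, b))}
      = ⋃ x ∈ (Finset.univ : Finset G),
        (fun ω => ((X₁ ω, A₁ ω), (X₂ ω, A₂ ω))) ⁻¹' {((x, a), (c - x, b))} := by
    ext ω
    simp only [Set.mem_preimage, Set.mem_singleton_iff, Prod.mk.injEq, Finset.mem_univ,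
      Set.iUnion_true, Set.mem_iUnion]
    constructor
    · rintro ⟨hc, ha, hb⟩
      exact ⟨X₁ ω, ⟨rfl, ha⟩, by rw [← hc]; abel, hb⟩
    · rintro ⟨x, ⟨rfl, ha⟩, hc, hb⟩
      exact ⟨by rw [hc]; abel, ha, hb⟩
  have hmeas : Measurable (fun ω => ((X₁ ω, A₁ ω), (X₂ ω, A₂ ω))) := by fun_prop
  rw [massOf, hset]
  exact measureReal_biUnion_finset
    (fun x _ y _ hxy => Set.disjoint_left.2 fun ω hx hy => hxy (by simp_all))
    (fun x _ => hmeas (measurableSet_singleton _))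

/-- **Lemma (suction at the upper end).** For every finite field `F_q` and every `γ > 0`
there is a `τ > 0` such that: if `(X₁, A₁)` and `(X₂, A₂)` are independent pairs of random
variables with `X₁, X₂ ∈ F_q`, and `1 − H̄(X₁|A₁) ≤ τ` and `1 − H̄(X₂|A₂) ≤ τ`, then
`1 − H̄(X₁+X₂ | A₁, A₂) ≤ γ · (1 − H̄(X₁|A₁))`. -/
theorem suction_at_upper_end
    (F : Type*) [Field F] [Fintype F] [MeasurableSpace F] [MeasurableSingletonClass F]
    (γ : ℝ) (hγ : 0 < γ) :
    ∃ τ : ℝ, 0 < τ ∧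
      ∀ (Ω : Type) [MeasurableSpace Ω] (μ : Measure Ω) [IsProbabilityMeasure μ]
        (T₁ T₂ : Type) [Fintype T₁] [Fintype T₂]
        [MeasurableSpace T₁] [MeasurableSingletonClass T₁]
        [MeasurableSpace T₂] [MeasurableSingletonClass T₂]
        (X₁ X₂ : Ω → F) (A₁ : Ω → T₁) (A₂ : Ω → T₂),
        Measurable X₁ → Measurable X₂ → Measurable A₁ → Measurable A₂ →
        IndepFun (fun ω => (X₁ ω, A₁ ω)) (fun ω => (X₂ ω, A₂ ω)) μ →
        1 - nCondEntropy μ X₁ A₁ ≤ τ → 1 - nCondEntropy μ X₂ A₂ ≤ τ →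
        1 - nCondEntropy μ (fun ω => X₁ ω + X₂ ω) (fun ω => (A₁ ω, A₂ ω)) ≤
          γ * (1 - nCondEntropy μ X₁ A₁) := by
  have hq : (0 : ℝ) < Fintype.card F := by exact_mod_cast Fintype.card_pos (α := F)
  have hlog : 0 < Real.log (Fintype.card F) :=
    Real.log_pos (by exact_mod_cast Fintype.one_lt_card)
  refine ⟨γ / (16 * (Fintype.card F : ℝ) ^ 2 * Real.log (Fintype.card F)), by positivity, ?_⟩
  intro Ω _ μ _ T₁ T₂ _ _ _ _ _ _ X₁ X₂ A₁ A₂ hX₁ hX₂ hA₁ hA₂ hind _ hτ₂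
  have hA : Measurable (fun ω => (A₁ ω, A₂ ω)) := hA₁.prodMk hA₂
  have hindA : IndepFun A₁ A₂ μ := hind.comp measurable_snd measurable_snd
  rw [one_sub_nCondEntropy μ X₂ hA₂, div_le_iff₀ hlog] at hτ₂
  rw [one_sub_nCondEntropy μ X₁ hA₁, one_sub_nCondEntropy μ _ hA, mul_div_assoc']
  refine div_le_div_of_nonneg_right ?_ hlog.le
  have hterm : ∀ a b, massOf μ (fun ω => (A₁ ω, A₂ ω)) (a, b)
      * uniformDivergence (massOf (μ[|(fun ω => (A₁ ω, A₂ ω)) ⁻¹' {(a, b)}])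
          (fun ω => X₁ ω + X₂ ω))
      ≤ 16 * (Fintype.card F : ℝ) ^ 2
        * ((massOf μ A₁ a * uniformDivergence (massOf (μ[|A₁ ⁻¹' {a}]) X₁))
          * (massOf μ A₂ b * uniformDivergence (massOf (μ[|A₂ ⁻¹' {b}]) X₂))) := by
    intro a b
    rw [massOf_pair_of_indepFun hindA]
    by_cases ha : massOf μ A₁ a = 0
    · simp [ha]
    by_cases hb : massOf μ A₂ b = 0
    · simp [hb]
    have hconv := uniformDivergence_convolution_le
      (s := massOf (μ[|(fun ω => (A₁ ω, A₂ ω)) ⁻¹' {(a, b)}]) (fun ω => X₁ ω + X₂ ω))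
      (massOf_nonneg _ _) (sum_massOf_cond μ hX₁ A₁ ha)
      (massOf_nonneg _ _) (sum_massOf_cond μ hX₂ A₂ hb) (fun c => by
        simp_rw [massOf_cond μ _ hA, massOf_cond μ _ hA₁, massOf_cond μ _ hA₂]
        rw [massOf_pair_of_indepFun hindA, massOf_add_pair hX₁ hX₂ hA₁ hA₂ hind,
          Finset.mul_sum]
        refine Finset.sum_congr rfl fun x _ => ?_
        rw [mul_inv]
        ring)
    refine (mul_le_mul_of_nonneg_left hconv
      (mul_nonneg (massOf_nonneg μ A₁ a) (massOf_nonneg μ A₂ b))).trans_eq ?_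
    ring
  have hnonneg : 0 ≤ ∑ a, massOf μ A₁ a * uniformDivergence (massOf (μ[|A₁ ⁻¹' {a}]) X₁) := by
    refine Finset.sum_nonneg fun a _ => ?_
    by_cases ha : massOf μ A₁ a = 0
    · simp [ha]
    · exact mul_nonneg (massOf_nonneg _ _ _)
        (uniformDivergence_nonneg (massOf_nonneg _ _) (sum_massOf_cond μ hX₁ A₁ ha))
  rw [Fintype.sum_prod_type]
  refine (Finset.sum_le_sum fun a _ => Finset.sum_le_sum fun b _ => hterm a b).trans ?_
  simp_rw [← Finset.mul_sum, ← Finset.sum_mul]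
  refine (mul_le_mul_of_nonneg_left (mul_le_mul_of_nonneg_left hτ₂ hnonneg)
    (by positivity)).trans_eq ?_
  field_simp
end

section
/- For every γ ∈ (0,1) there exists α₀ > 0 (one may take α₀ = 2^{−9/γ}) such that the following holds: if U and V are independent binary ({0,1}-valued) random variables with H(U) ≤ α₀ and H(V) ≤ α₀, then H(U ⊕ V) ≥ (1 − γ)·(H(U) + H(V)), where ⊕ is addition modulo 2. -/
open MeasureTheory ProbabilityTheory Real Finset

instance : MeasurableSpace (ZMod 2) := ⊤
instance : MeasurableSingletonClass (ZMod 2) := ⟨fun _ => MeasurableSpace.measurableSet_top⟩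

theorem negMulLog_add_negMulLog_le {p q : ℝ} (hp : 0 ≤ p) (hq : 0 ≤ q) :
    negMulLog p + negMulLog q ≤ negMulLog (p + q) + (p + q) * Real.log 2 := by
  have hconc := Real.concaveOn_negMulLog.2 (Set.mem_Ici.2 hp) (Set.mem_Ici.2 hq)
    (by norm_num : (0 : ℝ) ≤ 1 / 2) (by norm_num : (0 : ℝ) ≤ 1 / 2) (by norm_num)
  simp only [smul_eq_mul] at hconc
  rw [show 1 / 2 * p + 1 / 2 * q = (p + q) * (1 / 2) by ring, Real.negMulLog_mul] at hconc
  have hhalf : negMulLog (1 / 2) = Real.log 2 / 2 := by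
    rw [Real.negMulLog, one_div, Real.log_inv]
    ring
  rw [hhalf] at hconc
  linarith

theorem negMulLog_one_sub_le {p : ℝ} (hp : p < 1) : negMulLog (1 - p) ≤ p := by
  have hpos : 0 < 1 - p := by linarith
  have hlog := Real.one_sub_inv_le_log_of_pos hpos
  have hmul := mul_le_mul_of_nonneg_left hlog hpos.le
  rw [mul_sub, mul_inv_cancel₀ hpos.ne'] at hmul
  rw [Real.negMulLog]
  linarith

theorem mul_log_two_le_binEntropy {p : ℝ} (hp0 : 0 ≤ p) (hp : p ≤ 1 / 2) :
    p * Real.log 2 ≤ binEntropy p := by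
  rw [Real.binEntropy_eq_negMulLog_add_negMulLog_one_sub]
  have hother := Real.negMulLog_nonneg (by linarith : (0 : ℝ) ≤ 1 - p) (by linarith)
  rcases hp0.eq_or_lt with rfl | hpos
  · simp
  have hlog := Real.log_le_log hpos hp
  rw [one_div, Real.log_inv] at hlog
  have hmul := mul_le_mul_of_nonneg_left hlog hp0
  rw [Real.negMulLog.eq_def p]
  linarith

theorem binEntropy_binary_convolution_ge_of_le {γ p q : ℝ} (hγ0 : 0 < γ) (hγ1 : γ < 1)
    (hp0 : 0 ≤ p) (hq0 : 0 ≤ q) (hp : p ≤ exp (-(4 / γ)) / 2) (hq : q ≤ exp (-(4 / γ)) / 2) :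
    (1 - γ) * (binEntropy p + binEntropy q) ≤ binEntropy (p + q - 2 * p * q) := by
  set δ : ℝ := exp (-(4 / γ)) with hδ
  have hδγ : δ ≤ γ := by
    have hexp := Real.add_one_le_exp (4 / γ)
    have hfrac : 1 / γ ≤ 4 / γ := by gcongr; norm_num
    rw [hδ, Real.exp_neg]
    exact inv_le_of_inv_le₀ hγ0 (by rw [← one_div]; linarith)
  rcases (add_nonneg hp0 hq0).eq_or_lt with hs | hs
  · obtain rfl : p = 0 := by linarith
    obtain rfl : q = 0 := by linarith
    simp
  have hL : 4 / γ ≤ -Real.log (p + q) := by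
    have := Real.log_le_log hs (by linarith : p + q ≤ δ)
    rw [hδ, Real.log_exp] at this
    linarith
  have hLγ : 4 ≤ γ * -Real.log (p + q) := by
    rw [div_le_iff₀ hγ0] at hL
    linarith
  have hpq : 0 ≤ p * q := mul_nonneg hp0 hq0
  have hr : (1 - γ / 2) * (p + q) ≤ p + q - 2 * p * q := by
    nlinarith [mul_le_mul_of_nonneg_left (hp.trans (by linarith : δ / 2 ≤ γ / 2)) hq0,
      mul_le_mul_of_nonneg_left (hq.trans (by linarith : δ / 2 ≤ γ / 2)) hp0]
  have hrpos : 0 < p + q - 2 * p * q := lt_of_lt_of_le (mul_pos (by linarith) hs) hr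
  have hlogr : -Real.log (p + q) ≤ -Real.log (p + q - 2 * p * q) :=
    neg_le_neg (Real.log_le_log hrpos (by linarith))
  have hLpos : 0 ≤ -Real.log (p + q) := (by positivity : 0 ≤ 4 / γ).trans hL
  have hlower : (1 - γ / 2) * (p + q) * -Real.log (p + q) ≤ negMulLog (p + q - 2 * p * q) := by
    calc _ ≤ (p + q - 2 * p * q) * -Real.log (p + q - 2 * p * q) := by gcongr
      _ = _ := by rw [Real.negMulLog]; ring
  have hupper : binEntropy p + binEntropy q ≤ (p + q) * (-Real.log (p + q) + 2) := by
    rw [Real.binEntropy_eq_negMulLog_add_negMulLog_one_sub,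
      Real.binEntropy_eq_negMulLog_add_negMulLog_one_sub]
    have h := negMulLog_add_negMulLog_le hp0 hq0
    have hp1 := negMulLog_one_sub_le (by linarith : p < 1)
    have hq1 := negMulLog_one_sub_le (by linarith : q < 1)
    have hlog2 : (p + q) * Real.log 2 ≤ (p + q) * 1 := by
      gcongr
      linarith [Real.log_two_lt_d9]
    rw [Real.negMulLog.eq_def (p + q)] at h
    linarith
  have hother : 0 ≤ negMulLog (1 - (p + q - 2 * p * q)) :=
    Real.negMulLog_nonneg (by linarith) (by linarith)
  have hcoef : (1 - γ) * (-Real.log (p + q) + 2) ≤ (1 - γ / 2) * -Real.log (p + q) := by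
    linarith
  calc (1 - γ) * (binEntropy p + binEntropy q)
      ≤ (1 - γ) * ((p + q) * (-Real.log (p + q) + 2)) :=
        mul_le_mul_of_nonneg_left hupper (by linarith)
    _ = (p + q) * ((1 - γ) * (-Real.log (p + q) + 2)) := by ring
    _ ≤ (p + q) * ((1 - γ / 2) * -Real.log (p + q)) := by gcongr
    _ ≤ binEntropy (p + q - 2 * p * q) := by
      rw [Real.binEntropy_eq_negMulLog_add_negMulLog_one_sub]
      linarith

theorem binEntropy_binary_convolution_ge {γ p q : ℝ} (hγ0 : 0 < γ) (hγ1 : γ < 1)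
    (hp0 : 0 ≤ p) (hp1 : p ≤ 1) (hq0 : 0 ≤ q) (hq1 : q ≤ 1)
    (hp : binEntropy p ≤ exp (-(4 / γ)) / 2 * Real.log 2)
    (hq : binEntropy q ≤ exp (-(4 / γ)) / 2 * Real.log 2) :
    (1 - γ) * (binEntropy p + binEntropy q) ≤ binEntropy (p + q - 2 * p * q) := by
  have hsmall : ∀ {x : ℝ}, 0 ≤ x → x ≤ 1 / 2 →
      binEntropy x ≤ exp (-(4 / γ)) / 2 * Real.log 2 → x ≤ exp (-(4 / γ)) / 2 :=
    fun hx0 hx h => le_of_mul_le_mul_right ((mul_log_two_le_binEntropy hx0 hx).trans h)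
      (Real.log_pos one_lt_two)
  wlog hp2 : p ≤ 1 / 2 generalizing p
  · have h := this (p := 1 - p) (by linarith) (by linarith)
      (by rwa [Real.binEntropy_one_sub]) (by linarith)
    rwa [Real.binEntropy_one_sub, ← Real.binEntropy_one_sub (1 - p + q - 2 * (1 - p) * q),
      show 1 - (1 - p + q - 2 * (1 - p) * q) = p + q - 2 * p * q by ring] at h
  wlog hq2 : q ≤ 1 / 2 generalizing q
  · have h := this (q := 1 - q) (by linarith) (by linarith)
      (by rwa [Real.binEntropy_one_sub]) (by linarith)
    rwa [Real.binEntropy_one_sub, ← Real.binEntropy_one_sub (p + (1 - q) - 2 * p * (1 - q)),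
      show 1 - (p + (1 - q) - 2 * p * (1 - q)) = p + q - 2 * p * q by ring] at h
  exact binEntropy_binary_convolution_ge_of_le hγ0 hγ1 hp0 hq0 (hsmall hp0 hp2 hp)
    (hsmall hq0 hq2 hq)

section Binary

variable {Ω : Type*} [MeasurableSpace Ω] {μ : Measure Ω} [IsProbabilityMeasure μ]
  {U V : Ω → ZMod 2}

theorem massOf_zero_eq_one_sub (hU : Measurable U) : massOf μ U 0 = 1 - massOf μ U 1 := by
  have hcompl : U ⁻¹' {0} = (U ⁻¹' {1})ᶜ := by
    ext ω
    have hbit : ∀ u : ZMod 2, u = 0 ↔ ¬u = 1 := by decide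
    simpa using hbit (U ω)
  rw [massOf, hcompl]
  exact probReal_compl_eq_one_sub (hU (measurableSet_singleton 1))

theorem entropy_eq_binEntropy (hU : Measurable U) :
    entropy μ U = binEntropy (massOf μ U 1) / Real.log 2 := by
  rw [entropy, Real.binEntropy_eq_negMulLog_add_negMulLog_one_sub, ← massOf_zero_eq_one_sub hU,
    show ∑ a : ZMod 2, negMulLog (massOf μ U a) =
      negMulLog (massOf μ U 0) + negMulLog (massOf μ U 1) from Fin.sum_univ_two _, add_comm]

theorem massOf_add_one (hU : Measurable U) (hV : Measurable V) (hUV : IndepFun U V μ) :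
    massOf μ (fun ω => U ω + V ω) 1 =
      massOf μ U 1 + massOf μ V 1 - 2 * massOf μ U 1 * massOf μ V 1 := by
  have hinter : ∀ a b : ZMod 2,
      μ.real (U ⁻¹' {a} ∩ V ⁻¹' {b}) = massOf μ U a * massOf μ V b := fun a b => by
    rw [measureReal_def, hUV.measure_inter_preimage_eq_mul _ _ (measurableSet_singleton a)
      (measurableSet_singleton b), ENNReal.toReal_mul, massOf, massOf]
  have hunion : (fun ω => U ω + V ω) ⁻¹' {1} =
      U ⁻¹' {1} ∩ V ⁻¹' {0} ∪ U ⁻¹' {0} ∩ V ⁻¹' {1} := by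
    ext ω
    have hbit : ∀ u v : ZMod 2, u + v = 1 ↔ u = 1 ∧ v = 0 ∨ u = 0 ∧ v = 1 := by decide
    simpa using hbit (U ω) (V ω)
  have hdisj : Disjoint (U ⁻¹' {1} ∩ V ⁻¹' {0}) (U ⁻¹' {0} ∩ V ⁻¹' {1}) :=
    ((Set.disjoint_singleton.2 one_ne_zero).preimage U).mono Set.inter_subset_left
      Set.inter_subset_left
  rw [massOf, hunion, ← measureReal_def, measureReal_union hdisj
    ((hU (measurableSet_singleton 0)).inter (hV (measurableSet_singleton 1))), hinter, hinter,
    massOf_zero_eq_one_sub hU, massOf_zero_eq_one_sub hV]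
  ring

end Binary

/-- **Lemma (suction at the lower end, binary case).** For every `γ ∈ (0,1)` there is
`α₀ > 0` such that for independent binary random variables `U, V` with `H(U), H(V) ≤ α₀`,
`H(U ⊕ V) ≥ (1 − γ)(H(U) + H(V))`, where `⊕` is addition modulo 2 and `H` is Shannon
entropy in bits. -/
theorem binary_suction_at_lower_end
    (γ : ℝ) (hγ0 : 0 < γ) (hγ1 : γ < 1) :
    ∃ α₀ : ℝ, 0 < α₀ ∧
      ∀ (Ω : Type) [MeasurableSpace Ω] (μ : Measure Ω) [IsProbabilityMeasure μ]
        (U V : Ω → ZMod 2), Measurable U → Measurable V → IndepFun U V μ →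
        entropy μ U ≤ α₀ → entropy μ V ≤ α₀ →
        (1 - γ) * (entropy μ U + entropy μ V) ≤ entropy μ (fun ω => U ω + V ω) := by
  have hlog2 : 0 < Real.log 2 := Real.log_pos one_lt_two
  refine ⟨exp (-(4 / γ)) / 2, by positivity, fun Ω _ μ _ U V hU hV hUV hHU hHV => ?_⟩
  rw [entropy_eq_binEntropy hU, div_le_iff₀ hlog2] at hHU
  rw [entropy_eq_binEntropy hV, div_le_iff₀ hlog2] at hHV
  have hsum : Measurable fun ω => U ω + V ω :=
    (measurable_of_countable fun x : ZMod 2 × ZMod 2 => x.1 + x.2).comp (hU.prodMk hV)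
  rw [entropy_eq_binEntropy hU, entropy_eq_binEntropy hV, entropy_eq_binEntropy hsum,
    massOf_add_one hU hV hUV, ← add_div, ← mul_div_assoc]
  gcongr
  exact binEntropy_binary_convolution_ge hγ0 hγ1 measureReal_nonneg measureReal_le_one
    measureReal_nonneg measureReal_le_one hHU hHV
end
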